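/- arXiv:2110.11336 — 2 statements merged into one kernel-verified Lean document; each statement's English description precedes it below -/
import Mathlib

section
/- Let (Ω, S, ν) be a finite non-atomic measure space, A ∈ S with ν(A) > 0, A_1, …, A_n ⊆ A measurable, and m_1, …, m_n > 0 reals. Then there exist pairwise disjoint measurable sets B_k ⊆ A_k with ν(B_k) = m_k for all k ∈ [n] if and only if ν(⋃_{i∈I} A_i) ≥ ∑_{i∈I} m_i for all I ⊆ [n]. -/
open MeasureTheory

open Filter Set in
/-- A family of sets closed under increasing countable unions has, for a finite measure,
an element that cannot be enlarged inside the family to a set of larger measure. -/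
theorem exists_measureReal_maximal {Ω : Type*} [MeasurableSpace Ω] (ν : Measure Ω)
    [IsFiniteMeasure ν] (P : Set Ω → Prop) {S₀ : Set Ω} (h₀ : P S₀)
    (hP : ∀ s : ℕ → Set Ω, Monotone s → (∀ n, P (s n)) → P (⋃ n, s n)) :
    ∃ S, P S ∧ ∀ T, P T → S ⊆ T → ν.real T ≤ ν.real S := by
  have step : ∀ (n : ℕ) (B : {S // P S}), ∃ T : {S // P S}, B.1 ⊆ T.1 ∧
      ∀ T', P T' → B.1 ⊆ T' → ν.real T' ≤ ν.real T.1 + 1 / ((n : ℝ) + 1) := by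
    intro n B
    let V : Set ℝ := {x | ∃ T, P T ∧ B.1 ⊆ T ∧ ν.real T = x}
    have hne : V.Nonempty := ⟨_, B.1, B.2, subset_rfl, rfl⟩
    have hbdd : BddAbove V := by
      refine ⟨ν.real univ, ?_⟩
      rintro _ ⟨T, -, -, rfl⟩
      exact measureReal_mono (subset_univ T)
    obtain ⟨_, ⟨T, hT, hBT, rfl⟩, hlt⟩ := exists_lt_of_lt_csSup hne
      (sub_lt_self (sSup V) (Nat.one_div_pos_of_nat (α := ℝ) (n := n)))
    refine ⟨⟨T, hT⟩, hBT, fun T' hT' hBT' => ?_⟩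
    have := le_csSup hbdd (show ν.real T' ∈ V from ⟨T', hT', hBT', rfl⟩)
    linarith
  choose next hsub hnext using step
  let s : ℕ → {S // P S} := fun n => Nat.rec ⟨S₀, h₀⟩ next n
  have hmono : Monotone fun n => (s n).1 := monotone_nat_of_le_succ fun n => hsub n (s n)
  refine ⟨⋃ n, (s n).1, hP _ hmono fun n => (s n).2, fun T hT hST => ?_⟩
  refine ge_of_tendsto' (f := fun n : ℕ => ν.real (⋃ n, (s n).1) + 1 / ((n : ℝ) + 1)) (x := atTop)
    (by simpa using tendsto_one_div_add_atTop_nhds_zero_nat.const_add (ν.real (⋃ n, (s n).1)))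
    fun n => ?_
  have h := hnext n (s n) T hT ((subset_iUnion (fun n => (s n).1) n).trans hST)
  have h' : ν.real (s (n + 1)).1 ≤ ν.real (⋃ n, (s n).1) :=
    measureReal_mono (subset_iUnion (fun n => (s n).1) (n + 1))
  exact h.trans (by gcongr)

open Set in
/-- In a finite non-atomic measure space, every set of positive measure contains sets of
arbitrarily small positive measure. -/
theorem exists_subset_measureReal_lt {Ω : Type*} [MeasurableSpace Ω] (ν : Measure Ω)
    [IsFiniteMeasure ν]
    (hna : ∀ A : Set Ω, MeasurableSet A → 0 < ν A →
      ∃ B ⊆ A, MeasurableSet B ∧ 0 < ν B ∧ ν B < ν A)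
    {A : Set Ω} (hA : MeasurableSet A) (hpos : 0 < ν.real A) {ε : ℝ} (hε : 0 < ε) :
    ∃ D ⊆ A, MeasurableSet D ∧ 0 < ν.real D ∧ ν.real D < ε := by
  have half : ∀ n : ℕ, ∃ D ⊆ A, MeasurableSet D ∧ 0 < ν.real D ∧
      ν.real D ≤ ν.real A * (1 / 2) ^ n := by
    intro n
    induction n with
    | zero => exact ⟨A, subset_rfl, hA, hpos, by simp⟩
    | succ n ih =>
      obtain ⟨D, hDA, hD, hDpos, hDle⟩ := ih
      obtain ⟨B, hBD, hB, hB0, hBlt⟩ := hna D hD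
        ((ENNReal.toReal_pos_iff.1 hDpos).1)
      have hB0' : 0 < ν.real B := ENNReal.toReal_pos hB0.ne' (measure_ne_top _ _)
      have hBlt' : ν.real B < ν.real D :=
        (ENNReal.toReal_lt_toReal (measure_ne_top _ _) (measure_ne_top _ _)).2 hBlt
      have hdiff := measureReal_sdiff (μ := ν) hBD hB
      rw [pow_succ]
      rcases le_total (ν.real B) (ν.real D / 2) with h | h
      · exact ⟨B, hBD.trans hDA, hB, hB0', by linarith⟩
      · exact ⟨D \ B, sdiff_subset.trans hDA, hD.diff hB, by linarith, by linarith⟩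
  obtain ⟨n, hn⟩ := exists_pow_lt_of_lt_one (div_pos hε hpos) (by norm_num : (1 / 2 : ℝ) < 1)
  obtain ⟨D, hDA, hD, hDpos, hDle⟩ := half n
  refine ⟨D, hDA, hD, hDpos, hDle.trans_lt ?_⟩
  rwa [mul_comm, ← lt_div_iff₀ hpos]

open Filter Topology Set in
/-- Given finitely many upper bounds on the measures `ν (B ∩ C j)`, a subset `B` of `A` can be
grown until it has a prescribed measure or one of the bounds is attained. -/
theorem exists_subset_measureReal_eq_or_tight {Ω κ : Type*} [MeasurableSpace Ω] (ν : Measure Ω)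
    [IsFiniteMeasure ν]
    (hna : ∀ A : Set Ω, MeasurableSet A → 0 < ν A →
      ∃ B ⊆ A, MeasurableSet B ∧ 0 < ν B ∧ ν B < ν A)
    {A : Set Ω} (hA : MeasurableSet A) {a : ℝ} (ha : 0 ≤ a) (haA : a ≤ ν.real A)
    (T : Finset κ) (C : κ → Set Ω) (c : κ → ℝ) (hc : ∀ j ∈ T, 0 ≤ c j) :
    ∃ B ⊆ A, MeasurableSet B ∧ ν.real B ≤ a ∧ (∀ j ∈ T, ν.real (B ∩ C j) ≤ c j) ∧
      (ν.real B = a ∨ ∃ j ∈ T, ν.real (B ∩ C j) = c j) := by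
  have closed : ∀ (s : ℕ → Set Ω) (D : Set Ω) (d : ℝ), Monotone s →
      (∀ n, ν.real (s n ∩ D) ≤ d) → ν.real ((⋃ n, s n) ∩ D) ≤ d := by
    intro s D d hs hle
    rw [iUnion_inter]
    have hm : Monotone fun n => s n ∩ D := fun i j hij => inter_subset_inter_left D (hs hij)
    exact le_of_tendsto' ((ENNReal.tendsto_toReal (measure_ne_top ν _)).comp
      (tendsto_measure_iUnion_atTop hm)) hle
  obtain ⟨B, ⟨hBA, hB, hBa, hBc⟩, hmax⟩ := exists_measureReal_maximal ν
    (fun B => B ⊆ A ∧ MeasurableSet B ∧ ν.real B ≤ a ∧ ∀ j ∈ T, ν.real (B ∩ C j) ≤ c j)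
    (S₀ := ∅) ⟨empty_subset A, MeasurableSet.empty, by simpa using ha, by simpa using hc⟩
    (fun s hs h => ⟨iUnion_subset fun n => (h n).1, MeasurableSet.iUnion fun n => (h n).2.1,
      by simpa using closed s univ a hs (by simpa using fun n => (h n).2.2.1),
      fun j hj => closed s (C j) (c j) hs fun n => (h n).2.2.2 j hj⟩)
  refine ⟨B, hBA, hB, hBa, hBc, ?_⟩
  by_contra! hcon
  obtain ⟨hne, htight⟩ := hcon
  have hlt : ν.real B < a := lt_of_le_of_ne hBa hne
  obtain ⟨ε, ⟨hεa, hεc⟩, hε⟩ : ∃ ε : ℝ, (ε < a - ν.real B ∧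
      ∀ j ∈ T, ε < c j - ν.real (B ∩ C j)) ∧ 0 < ε := by
    have h1 : ∀ x : ℝ, 0 < x → ∀ᶠ ε in 𝓝[>] (0 : ℝ), ε < x := fun x hx =>
      nhdsWithin_le_nhds (eventually_lt_nhds hx)
    exact (((h1 _ (sub_pos.2 hlt)).and ((eventually_all_finset T).2 fun j hj =>
      h1 _ (sub_pos.2 (lt_of_le_of_ne (hBc j hj) (htight j hj))))).and
        self_mem_nhdsWithin).exists
  have hdiff := measureReal_sdiff (μ := ν) hBA hB
  obtain ⟨D, hDsub, hD, hDpos, hDlt⟩ := exists_subset_measureReal_lt ν hna (hA.diff hB)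
    (by linarith) hε
  have hunion : ν.real (B ∪ D) = ν.real B + ν.real D :=
    measureReal_union (disjoint_sdiff_right.mono_right hDsub) hD
  have := hmax (B ∪ D) ⟨union_subset hBA (hDsub.trans sdiff_subset), hB.union hD, by linarith,
    fun j hj => ?_⟩ subset_union_left
  · linarith
  · rw [union_inter_distrib_right]
    have h1 := measureReal_union_le (μ := ν) (B ∩ C j) (D ∩ C j)
    have h2 : ν.real (D ∩ C j) ≤ ν.real D := measureReal_mono inter_subset_left
    linarith [hεc j hj]

open Set in
/-- The sufficiency of Hall's condition for the indices in a finite set `s`, allowing zero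
demands. -/
theorem exists_disjoint_measureReal_eq {Ω ι : Type*} [MeasurableSpace Ω] (ν : Measure Ω)
    [IsFiniteMeasure ν]
    (hna : ∀ A : Set Ω, MeasurableSet A → 0 < ν A →
      ∃ B ⊆ A, MeasurableSet B ∧ 0 < ν B ∧ ν B < ν A)
    (s : Finset ι) (A : ι → Set Ω) (hA : ∀ i, MeasurableSet (A i)) (m : ι → ℝ)
    (hm : ∀ i, 0 ≤ m i) (hall : ∀ I ⊆ s, ∑ i ∈ I, m i ≤ ν.real (⋃ i ∈ I, A i)) :
    ∃ B : ι → Set Ω, (∀ i, MeasurableSet (B i)) ∧ (∀ i, B i ⊆ A i) ∧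
      (∀ i ∈ s, ν.real (B i) = m i) ∧ (s : Set ι).PairwiseDisjoint B := by
  classical
  induction s using Finset.strongInduction generalizing A m with
  | H s ih =>
  rcases s.eq_empty_or_nonempty with rfl | ⟨k, hk⟩
  · exact ⟨fun _ => ∅, fun _ => MeasurableSet.empty, fun i => empty_subset _, by simp, by simp⟩
  have hU : ∀ I : Finset ι, MeasurableSet (⋃ i ∈ I, A i) := fun I =>
    I.measurableSet_biUnion fun i _ => hA i
  have herase : s.erase k ⊂ s := Finset.erase_ssubset hk
  obtain ⟨B₀, hB₀A, hB₀, hB₀m, hB₀c, hor⟩ := exists_subset_measureReal_eq_or_tight ν hna (hA k)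
    (hm k) (by simpa using hall {k} (by simpa using hk))
    ((s.erase k).powerset.erase ∅) (fun I => ⋃ i ∈ I, A i)
    (fun I => ν.real (⋃ i ∈ I, A i) - ∑ i ∈ I, m i) (fun I hI => by
      rw [Finset.mem_erase, Finset.mem_powerset] at hI
      exact sub_nonneg.2 (hall I (hI.2.trans herase.subset)))
  have hsplit : ∀ I : Finset ι, ν.real (⋃ i ∈ I, A i \ B₀) =
      ν.real (⋃ i ∈ I, A i) - ν.real (B₀ ∩ ⋃ i ∈ I, A i) := by
    intro I
    have : (⋃ i ∈ I, A i \ B₀) = (⋃ i ∈ I, A i) \ B₀ := by simp only [iUnion_sdiff]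
    rw [this, inter_comm]
    linarith [measureReal_inter_add_sdiff (μ := ν) (s := ⋃ i ∈ I, A i) hB₀ (measure_ne_top _ _)]
  have hres : ∀ I ⊆ s.erase k, ∑ i ∈ I, m i ≤ ν.real (⋃ i ∈ I, A i \ B₀) := by
    intro I hI
    rcases I.eq_empty_or_nonempty with rfl | hIne
    · simp
    · have := hB₀c I (Finset.mem_erase.2 ⟨hIne.ne_empty, Finset.mem_powerset.2 hI⟩)
      rw [hsplit]
      linarith
  rcases hor with hfull | ⟨I, hI, htight⟩
  · obtain ⟨B, hB, hBA, hBm, hBd⟩ := ih _ herase (fun i => A i \ B₀)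
      (fun i => (hA i).diff hB₀) m hm hres
    refine ⟨Function.update B k B₀, fun i => ?_, fun i => ?_, fun i hi => ?_, ?_⟩
    · obtain rfl | h := eq_or_ne i k <;> simp [*]
    · obtain rfl | h := eq_or_ne i k
      · simpa using hB₀A
      · simpa [h] using (hBA i).trans sdiff_subset
    · obtain rfl | h := eq_or_ne i k
      · simpa using hfull
      · simpa [h] using hBm i (Finset.mem_erase.2 ⟨h, hi⟩)
    · have hdis : ∀ i, Disjoint (B i) B₀ := fun i => disjoint_sdiff_left.mono_left (hBA i)
      intro i hi j hj hij
      rw [Function.onFun]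
      obtain rfl | h := eq_or_ne i k
      · simpa [hij.symm] using (hdis j).symm
      · obtain rfl | h' := eq_or_ne j k
        · simpa [hij] using hdis i
        · simpa [h, h'] using hBd (Finset.mem_erase.2 ⟨h, hi⟩) (Finset.mem_erase.2 ⟨h', hj⟩) hij
  · rw [Finset.mem_erase, Finset.mem_powerset] at hI
    obtain ⟨hIne, hIk⟩ := hI
    have hIs : I ⊂ s := hIk.trans_ssubset herase
    have hkI : k ∉ I := fun h => Finset.notMem_erase k s (hIk h)
    have hIsd : s \ I ⊂ s :=
      Finset.sdiff_ssubset hIs.subset (Finset.nonempty_iff_ne_empty.2 hIne)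
    set U : Set Ω := ⋃ i ∈ I, A i with hUdef
    obtain ⟨B₁, hB₁, hB₁A, hB₁m, hB₁d⟩ := ih I hIs (fun i => A i \ B₀)
      (fun i => (hA i).diff hB₀) m hm (fun J hJ => hres J (hJ.trans hIk))
    have hresU : ∀ J ⊆ s \ I, ∑ i ∈ J, Function.update m k (m k - ν.real B₀) i ≤
        ν.real (⋃ i ∈ J, (A i \ B₀) \ U) := by
      intro J hJ
      have hJI : Disjoint J I := Finset.disjoint_of_subset_left hJ Finset.sdiff_disjoint
      have hJs : J ∪ I ⊆ s := Finset.union_subset (hJ.trans Finset.sdiff_subset) hIs.subset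
      have hset : (⋃ i ∈ J, (A i \ B₀) \ U) =
          (⋃ i ∈ J ∪ I, A i \ B₀) \ (⋃ i ∈ I, A i \ B₀) := by
        ext x
        simp only [hUdef, mem_iUnion, mem_sdiff, Finset.mem_union, exists_prop, not_exists, not_and]
        grind
      have hmI : MeasurableSet (⋃ i ∈ I, A i \ B₀) :=
        I.measurableSet_biUnion fun i _ => (hA i).diff hB₀
      have hsub : (⋃ i ∈ I, A i \ B₀) ⊆ ⋃ i ∈ J ∪ I, A i \ B₀ :=
        biUnion_subset_biUnion_left fun i hi => Finset.mem_union_right J hi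
      rw [hset, measureReal_sdiff hsub hmI (measure_ne_top _ _), hsplit I, htight]
      by_cases hkJ : k ∈ J
      · have hsum : ∑ i ∈ J, Function.update m k (m k - ν.real B₀) i =
            ∑ i ∈ J, m i - ν.real B₀ := by
          rw [Finset.sum_update_of_mem hkJ, ← Finset.sum_sdiff (Finset.singleton_subset_iff.2 hkJ),
            Finset.sum_singleton]
          ring
        have h1 := hall _ hJs
        have h2 : ν.real (B₀ ∩ ⋃ i ∈ J ∪ I, A i) ≤ ν.real B₀ := measureReal_mono inter_subset_left
        rw [Finset.sum_union hJI] at h1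
        rw [hsum, hsplit]
        linarith
      · have h1 := hres (J ∪ I) (Finset.subset_erase.2 ⟨hJs, by simp [hkJ, hkI]⟩)
        rw [Finset.sum_union hJI] at h1
        rw [Finset.sum_update_of_notMem hkJ]
        linarith
    obtain ⟨B₂, hB₂, hB₂A, hB₂m, hB₂d⟩ := ih (s \ I) hIsd (fun i => (A i \ B₀) \ U)
      (fun i => ((hA i).diff hB₀).diff (hU I)) (Function.update m k (m k - ν.real B₀))
      (fun i => by
        obtain rfl | h := eq_or_ne i k
        · simpa using hB₀m
        · simpa [h] using hm i) hresU
    have hd₁ : ∀ i, Disjoint (B₁ i) B₀ := fun i => disjoint_sdiff_left.mono_left (hB₁A i)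
    have hd₂ : ∀ i, Disjoint (B₂ i) B₀ := fun i =>
      disjoint_sdiff_left.mono_left ((hB₂A i).trans sdiff_subset)
    have hd₁₂ : ∀ i ∈ I, ∀ j, Disjoint (B₁ i) (B₂ j) := fun i hi j =>
      disjoint_sdiff_right.mono ((hB₁A i).trans (sdiff_subset.trans
        (subset_biUnion_of_mem (u := A) (Finset.mem_coe.2 hi)))) (hB₂A j)
    let E : ι → Set Ω := fun i => if i = k then B₀ else ∅
    have hE : ∀ i, E i ⊆ B₀ := fun i => by
      by_cases h : i = k <;> simp [E, h]
    have hEd : ∀ i j, i ≠ j → Disjoint (E i) (E j) := fun i j hij => by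
      by_cases h : i = k
      · simp [E, h, show j ≠ k from fun h' => hij (h.trans h'.symm)]
      · simp [E, h]
    have hEm : ∀ i, MeasurableSet (E i) := fun i => by
      by_cases h : i = k <;> simp [E, h, hB₀]
    have hEA : ∀ i, E i ⊆ A i := fun i => by
      by_cases h : i = k
      · simpa [E, h] using hB₀A
      · simp [E, h]
    refine ⟨fun i => if i ∈ I then B₁ i else B₂ i ∪ E i, fun i => ?_, fun i => ?_,
      fun i hi => ?_, fun i hi j hj hij => ?_⟩
    · dsimp only
      split_ifs
      exacts [hB₁ i, (hB₂ i).union (hEm i)]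
    · dsimp only
      split_ifs
      exacts [(hB₁A i).trans sdiff_subset,
        union_subset ((hB₂A i).trans (sdiff_subset.trans sdiff_subset)) (hEA i)]
    · dsimp only
      split_ifs with h
      · exact hB₁m i h
      · rw [measureReal_union ((hd₂ i).mono_right (hE i)) (hEm i),
          hB₂m i (Finset.mem_sdiff.2 ⟨hi, h⟩)]
        obtain rfl | h := eq_or_ne i k <;> simp [E, *]
    · simp only [Function.onFun]
      split_ifs with h h' h'
      · exact hB₁d h h' hij
      · exact (hd₁₂ i h j).union_right ((hd₁ i).mono_right (hE j))
      · exact ((hd₁₂ j h' i).union_right ((hd₁ j).mono_right (hE i))).symm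
      · exact ((hB₂d (Finset.mem_sdiff.2 ⟨hi, h⟩) (Finset.mem_sdiff.2 ⟨hj, h'⟩) hij).union_right
          ((hd₂ i).mono_right (hE j))).union_left
          (((hd₂ j).mono_right (hE i)).symm.union_right (hEd i j hij))

theorem stmt_5 {Ω : Type*} [MeasurableSpace Ω] (ν : Measure Ω) [IsFiniteMeasure ν]
    (hna : ∀ A : Set Ω, MeasurableSet A → 0 < ν A →
      ∃ B ⊆ A, MeasurableSet B ∧ 0 < ν B ∧ ν B < ν A)
    (A : Set Ω) (hA : MeasurableSet A) (hApos : 0 < ν A)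
    (n : ℕ) (A' : Fin n → Set Ω) (hA'meas : ∀ k, MeasurableSet (A' k))
    (hA'sub : ∀ k, A' k ⊆ A)
    (m : Fin n → ℝ) (hm : ∀ k, 0 < m k) :
    (∃ B : Fin n → Set Ω, (∀ k, MeasurableSet (B k)) ∧ (∀ k, B k ⊆ A' k) ∧
      (∀ k, ν (B k) = ENNReal.ofReal (m k)) ∧
      Pairwise (fun i j => Disjoint (B i) (B j))) ↔
    (∀ I : Finset (Fin n), ENNReal.ofReal (∑ i ∈ I, m i) ≤ ν (⋃ i ∈ I, A' i)) := by
  constructor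
  · rintro ⟨B, hB, hBA, hBm, hBd⟩ I
    calc ENNReal.ofReal (∑ i ∈ I, m i) = ∑ i ∈ I, ν (B i) := by
          simp only [hBm, ENNReal.ofReal_sum_of_nonneg fun i _ => (hm i).le]
      _ = ν (⋃ i ∈ I, B i) :=
          (measure_biUnion_finset (fun i _ j _ hij => hBd hij) fun i _ => hB i).symm
      _ ≤ ν (⋃ i ∈ I, A' i) := measure_mono (Set.iUnion₂_mono fun i _ => hBA i)
  · intro hall
    obtain ⟨B, hB, hBA, hBm, hBd⟩ := exists_disjoint_measureReal_eq ν hna Finset.univ A' hA'meas m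
      (fun i => (hm i).le) fun I _ =>
        (ENNReal.ofReal_le_iff_le_toReal (measure_ne_top _ _)).1 (hall I)
    refine ⟨B, hB, hBA, fun k => ?_, fun i j hij => hBd (by simp) (by simp) hij⟩
    rw [← hBm k (Finset.mem_univ k), ofReal_measureReal]
end

section
/- Let (Ω, S, ν) be a finite measure space and A_1, …, A_n measurable sets satisfying ν(⋃_{i∈I} A_i) ≥ ∑_{i∈I} m_i for all I ⊆ [n], where m_1, …, m_n > 0. Fix ξ with 0 < ξ ≤ min_k m_k/(2^{n+1}+1) and set d_{k,ξ} = ⌊m_k/ξ⌋ − 2^{n+1}. Then d_{k,ξ} > 0 for all k, and for every nonempty Q ⊆ [n], ν(⋃_{i∈Q} A_i) − ξ·(2^n − 2^{n−|Q|}) ≥ ξ·∑_{i∈Q} d_{i,ξ} > 0. -/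
open MeasureTheory

theorem stmt_11 {Ω : Type*} [MeasurableSpace Ω] (ν : Measure Ω) [IsFiniteMeasure ν]
    (n : ℕ) (A : Fin n → Set Ω) (hA : ∀ k, MeasurableSet (A k))
    (m : Fin n → ℝ) (hm : ∀ k, 0 < m k)
    (hHall : ∀ I : Finset (Fin n), ENNReal.ofReal (∑ i ∈ I, m i) ≤ ν (⋃ i ∈ I, A i))
    (ξ : ℝ) (hξ0 : 0 < ξ) (hξ : ∀ k, ξ ≤ m k / (2 ^ (n + 1) + 1))
    (d : Fin n → ℤ) (hd : ∀ k, d k = ⌊m k / ξ⌋ - 2 ^ (n + 1)) :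
    (∀ k, 0 < d k) ∧
    ∀ Q : Finset (Fin n), Q.Nonempty →
      0 < ξ * ∑ i ∈ Q, (d i : ℝ) ∧
      ξ * ∑ i ∈ Q, (d i : ℝ)
        ≤ (ν (⋃ i ∈ Q, A i)).toReal - ξ * ((2 : ℝ) ^ n - 2 ^ (n - Q.card)) := by
  have hd_pos : ∀ k, 0 < d k := fun k => by
    have h : (2 : ℝ) ^ (n + 1) + 1 ≤ m k / ξ := by
      have := (le_div_iff₀ (by positivity)).1 (hξ k)
      rw [le_div_iff₀ hξ0]
      linarith
    have h_floor : (2 : ℤ) ^ (n + 1) + 1 ≤ ⌊m k / ξ⌋ := Int.le_floor.2 (by exact_mod_cast h)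
    rw [hd]
    linarith
  refine ⟨hd_pos, fun Q hQ => ⟨?_, ?_⟩⟩
  · exact mul_pos hξ0 (Finset.sum_pos (fun i _ => by exact_mod_cast hd_pos i) hQ)
  have hd_le : ∀ i ∈ Q, ξ * (d i : ℝ) ≤ m i - ξ * 2 ^ (n + 1) := fun i _ => by
    have h := (le_div_iff₀ hξ0).1 (Int.floor_le (m i / ξ))
    rw [hd]
    push_cast
    linarith
  have h_sum : ξ * ∑ i ∈ Q, (d i : ℝ) ≤ ∑ i ∈ Q, m i - Q.card * (ξ * 2 ^ (n + 1)) := by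
    rw [Finset.mul_sum]
    exact (Finset.sum_le_sum hd_le).trans_eq (by simp [Finset.sum_sub_distrib])
  have h_hall : ∑ i ∈ Q, m i ≤ (ν (⋃ i ∈ Q, A i)).toReal :=
    (ENNReal.ofReal_le_iff_le_toReal (measure_ne_top ν _)).1 (hHall Q)
  have h_card : (1 : ℝ) ≤ Q.card := by exact_mod_cast hQ.card_pos
  have h_pow : ξ * 2 ^ (n + 1) ≤ Q.card * (ξ * 2 ^ (n + 1)) :=
    le_mul_of_one_le_left (by positivity) h_card
  have h_slack : ξ * ((2 : ℝ) ^ n - 2 ^ (n - Q.card)) ≤ ξ * 2 ^ (n + 1) := by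
    gcongr
    have : (0 : ℝ) < 2 ^ n := by positivity
    have : (0 : ℝ) < 2 ^ (n - Q.card) := by positivity
    rw [pow_succ]
    linarith
  linarith
end
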